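/- Let Γ be a finite simplicial graph, let A(Γ) act without inversions on a simplicial tree T, and suppose v ∈ V(Γ) acts hyperbolically on T with all edge stabilizers of T abelian. Write star(v) = star_h(v) ⊔ star_e(v), where the vertices of star_h(v) act hyperbolically on T and those of star_e(v) act elliptically, and set Γ′ = Γ∖star_h(v). Then A(Γ) decomposes as the amalgamated free product A(Γ′) ∗_{A(star_e(v))} A(star(v)), where A(star(v)) is free abelian. -/

import Mathlib

/-- The relators of the right-angled Artin group of a graph `Γ`: one commutator
relator for each pair of adjacent vertices. -/
def raagRels {V : Type} (Γ : SimpleGraph V) : Set (FreeGroup V) :=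
  {r | ∃ u v : V, Γ.Adj u v ∧
    r = FreeGroup.of u * FreeGroup.of v * (FreeGroup.of u)⁻¹ * (FreeGroup.of v)⁻¹}

/-- The right-angled Artin group `A(Γ)` of a graph `Γ`. -/
abbrev RAAG {V : Type} (Γ : SimpleGraph V) : Type := PresentedGroup (raagRels Γ)

/-- The generator of `RAAG Γ` corresponding to a vertex `v`. -/
def RAAG.gen {V : Type} (Γ : SimpleGraph V) (v : V) : RAAG Γ := PresentedGroup.of v

section Action

variable {G W : Type} [Group G]

/-- The homomorphism `φ : G →* Equiv.Perm W` acts by automorphisms of the graph `T`. -/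
def PreservesAdj (T : SimpleGraph W) (φ : G →* Equiv.Perm W) : Prop :=
  ∀ (g : G) (u v : W), T.Adj u v → T.Adj (φ g u) (φ g v)

/-- The action `φ` on the graph `T` is without edge inversions. -/
def NoInversions (T : SimpleGraph W) (φ : G →* Equiv.Perm W) : Prop :=
  ∀ (g : G) (u v : W), T.Adj u v → ¬(φ g u = v ∧ φ g v = u)

/-- All edge stabilizers of the action `φ` on the graph `T` are abelian: any two
elements fixing both endpoints of an edge commute. -/
def AbelianEdgeStabilizers (T : SimpleGraph W) (φ : G →* Equiv.Perm W) : Prop :=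
  ∀ u v : W, T.Adj u v → ∀ g h : G,
    φ g u = u → φ g v = v → φ h u = u → φ h v = v → g * h = h * g

/-- An element `g` is elliptic for the action `φ` if it fixes some vertex. -/
def Elliptic (φ : G →* Equiv.Perm W) (g : G) : Prop := ∃ w : W, φ g w = w

/-- The action `φ` has a global fixed vertex. -/
def HasGlobalFixedVertex (φ : G →* Equiv.Perm W) : Prop := ∃ w : W, ∀ g : G, φ g w = w

end Action

/-- `K` is a separating clique of `Γ`: a clique whose removal disconnects `Γ`. -/
def SeparatingClique {V : Type} (Γ : SimpleGraph V) (K : Set V) : Prop :=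
  Γ.IsClique K ∧ ∃ x y : ↥(Kᶜ), ¬ (Γ.induce Kᶜ).Reachable x y

/-- Given subgroups `AK ≤ A0` and `AK ≤ A1` of a group, the pair of inclusion
homomorphisms, indexed by `Bool`, defining the amalgamated free product
`A0 ∗_{AK} A1` as a pushout. -/
def amalgMaps {G : Type} [Group G] {AK A0 A1 : Subgroup G}
    (h0 : AK ≤ A0) (h1 : AK ≤ A1) : (i : Bool) → (↥AK →* ↥(cond i A1 A0))
  | false => Subgroup.inclusion h0
  | true => Subgroup.inclusion h1

namespace SimpleGraph

variable {W : Type*} {T : SimpleGraph W}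

/-- The half-tree at the head of an oriented edge `e`: the component of `e.2` once the
edge `e` is removed. -/
def halfTree (T : SimpleGraph W) (e : W × W) : Set W :=
  {w | (T.deleteEdges {s(e.1, e.2)}).Reachable w e.2}

lemma snd_mem_halfTree (e : W × W) : e.2 ∈ T.halfTree e := Reachable.refl _

lemma IsTree.fst_notMem_halfTree (hT : T.IsTree) {e : W × W} (he : T.Adj e.1 e.2) :
    e.1 ∉ T.halfTree e :=
  isBridge_iff.1 (isAcyclic_iff_forall_isBridge.1 hT.2 ((T.mem_edgeSet).2 he))

lemma IsTree.eq_of_crosses_halfTree (hT : T.IsTree) {e : W × W} (he : T.Adj e.1 e.2) {a b : W}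
    (hab : T.Adj a b) (ha : a ∈ T.halfTree e) (hb : b ∉ T.halfTree e) : e = (b, a) := by
  by_cases h : s(a, b) = s(e.1, e.2)
  · rcases Sym2.eq_iff.1 h with ⟨rfl, rfl⟩ | ⟨rfl, rfl⟩
    · exact absurd ha (hT.fst_notMem_halfTree he)
    · rfl
  · have hadj : (T.deleteEdges {s(e.1, e.2)}).Adj b a := by
      rw [deleteEdges_adj]
      exact ⟨hab.symm, fun h' => h (by rw [Sym2.eq_swap]; exact h')⟩
    exact absurd (hadj.reachable.trans ha) hb

lemma IsTree.mem_halfTree_swap (hT : T.IsTree) {e : W × W} (he : T.Adj e.1 e.2) {w : W}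
    (hw : w ∉ T.halfTree e) : w ∈ T.halfTree e.swap := by
  obtain ⟨p⟩ := hT.1.preconnected w e.2
  by_contra hw'
  have key : ∀ {a b : W} (p : T.Walk a b), b ∈ T.halfTree e ∪ T.halfTree e.swap →
      a ∈ T.halfTree e ∪ T.halfTree e.swap := by
    intro a b p
    induction p with
    | nil => exact id
    | cons hab _ ih =>
      intro hb
      by_contra ha
      simp only [Set.mem_union, not_or] at ha
      rcases ih hb with h | h
      · have := hT.eq_of_crosses_halfTree he hab.symm h ha.1
        subst this
        exact ha.2 (snd_mem_halfTree _)
      · have := hT.eq_of_crosses_halfTree (e := e.swap) he.symm hab.symm h ha.2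
        rw [Prod.swap_eq_iff_eq_swap] at this
        subst this
        exact ha.1 (snd_mem_halfTree _)
  exact (key p (Or.inl (snd_mem_halfTree e))).elim hw hw'

lemma IsTree.exists_walk_length_lt (hT : T.IsTree) {e : W × W} (he : T.Adj e.1 e.2) {z : W}
    (hz : z ∈ T.halfTree e) (p : T.Walk z e.1) : ∃ q : T.Walk z e.2, q.length < p.length := by
  suffices H : ∀ {z x : W} (p : T.Walk z x), x = e.1 → z ∈ T.halfTree e →
      ∃ q : T.Walk z e.2, q.length < p.length from H p rfl hz
  clear p hz
  intro z x p
  induction p with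
  | nil =>
    rintro rfl hz
    exact absurd hz (hT.fst_notMem_halfTree he)
  | @cons a b c hab p ih =>
    intro hc ha
    by_cases hb : b ∈ T.halfTree e
    · obtain ⟨q, hq⟩ := ih hc hb
      exact ⟨q.cons hab, by simpa using hq⟩
    · have := hT.eq_of_crosses_halfTree he hab ha hb
      subst this
      exact ⟨Walk.nil, by simp⟩

lemma IsTree.finite_separating (hT : T.IsTree) (p q : W) :
    {e : W × W | T.Adj e.1 e.2 ∧ p ∉ T.halfTree e ∧ q ∈ T.halfTree e}.Finite := by
  obtain ⟨w⟩ := hT.1.preconnected p q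
  induction w with
  | nil => exact Set.finite_empty.subset fun e he => he.2.1 he.2.2
  | @cons a b c hab _ ih =>
    refine (ih.insert (a, b)).subset fun e he => ?_
    by_cases hb : b ∈ T.halfTree e
    · exact Or.inl (hT.eq_of_crosses_halfTree he.1 hab.symm hb he.2.1)
    · exact Or.inr ⟨he.1, hb, he.2.2⟩

section Action

variable {G : Type*} [Group G] [MulAction G W]

lemma smul_mem_halfTree (hadj : ∀ (g : G) (u v : W), T.Adj u v → T.Adj (g • u) (g • v))
    (g : G) {e : W × W} {w : W} (hw : w ∈ T.halfTree e) : g • w ∈ T.halfTree (g • e) := by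
  refine Reachable.map (G := T.deleteEdges {s(e.1, e.2)})
    (G' := T.deleteEdges {s(g • e.1, g • e.2)}) ⟨fun x => g • x, ?_⟩ hw
  intro a b hab
  rw [deleteEdges_adj] at hab ⊢
  refine ⟨hadj g _ _ hab.1, fun h => hab.2 ?_⟩
  simpa only [Set.mem_singleton_iff, Sym2.eq_iff, smul_left_cancel_iff, RelHom.coeFn_mk] using h

lemma smul_mem_halfTree_iff (hadj : ∀ (g : G) (u v : W), T.Adj u v → T.Adj (g • u) (g • v))
    (g : G) {e : W × W} {w : W} : g • w ∈ T.halfTree (g • e) ↔ w ∈ T.halfTree e := by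
  refine ⟨fun h => ?_, smul_mem_halfTree hadj g⟩
  simpa using smul_mem_halfTree hadj g⁻¹ h

/-- The oriented edges whose half-tree is mapped into itself by `g`. For hyperbolic `g` these
are the edges of the axis of `g`, oriented in the direction of translation. -/
def axisEdges (T : SimpleGraph W) (g : G) : Set (W × W) :=
  {e | T.Adj e.1 e.2 ∧ T.halfTree (g • e) ⊆ T.halfTree e}

lemma smul_mem_axisEdges (hadj : ∀ (g : G) (u v : W), T.Adj u v → T.Adj (g • u) (g • v))
    {g u : G} (hu : Commute u g) {e : W × W} (he : e ∈ T.axisEdges g) :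
    u • e ∈ T.axisEdges g := by
  refine ⟨hadj u _ _ he.1, fun w hw => ?_⟩
  rw [smul_smul, ← hu.eq, ← smul_smul] at hw
  rw [← smul_inv_smul u w, smul_mem_halfTree_iff hadj] at hw ⊢
  exact he.2 hw

lemma IsTree.axisEdges_nonempty (hT : T.IsTree)
    (hadj : ∀ (g : G) (u v : W), T.Adj u v → T.Adj (g • u) (g • v)) {g : G}
    (hinv : ∀ u v : W, T.Adj u v → ¬ (g • u = v ∧ g • v = u)) (hg : ∀ w : W, g • w ≠ w) :
    (T.axisEdges g).Nonempty := by
  classical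
  have hne : ∃ n : ℕ, ∃ (w : W) (p : T.Walk w (g • w)), p.length = n := by
    obtain ⟨w⟩ := hT.1.nonempty
    obtain ⟨p⟩ := hT.1.preconnected w (g • w)
    exact ⟨_, w, p, rfl⟩
  obtain ⟨w, p, hp⟩ := Nat.find_spec hne
  have hmin : ∀ (w' : W) (q : T.Walk w' (g • w')), p.length ≤ q.length :=
    fun w' q => hp.le.trans (Nat.find_min' hne ⟨w', q, rfl⟩)
  obtain ⟨w₁, h, p', rfl⟩ := Walk.exists_eq_cons_of_ne (hg w).symm p
  have he : T.Adj (w, w₁).1 (w, w₁).2 := h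
  have hge : T.Adj (g • (w, w₁)).1 (g • (w, w₁)).2 := hadj g _ _ h
  have hgw : g • w ∈ T.halfTree (w, w₁) := by
    by_contra hgw
    obtain ⟨q, hq⟩ := hT.exists_walk_length_lt h.symm (hT.mem_halfTree_swap he hgw) p'.reverse
    have := hmin w q.reverse
    simp only [Walk.length_reverse, Walk.length_cons] at this hq
    omega
  have hw₁ : w₁ ∉ T.halfTree (g • (w, w₁)) := by
    intro hw₁
    obtain ⟨q, hq⟩ := hT.exists_walk_length_lt hge hw₁ p'
    have := hmin w₁ q
    simp only [Walk.length_cons] at this hq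
    omega
  have hw : w ∉ T.halfTree (g • (w, w₁)) := by
    intro hw
    have := hT.eq_of_crosses_halfTree hge h hw hw₁
    simp only [Prod.smul_mk, Prod.mk.injEq] at this
    exact hinv w w₁ h this
  refine ⟨(w, w₁), he, fun z hz => ?_⟩
  by_contra hz'
  obtain ⟨r⟩ := hT.mem_halfTree_swap he hz'
  have key : ∀ {a b : W} (r : (T.deleteEdges {s(w, w₁)}).Walk a b), a ∉ T.halfTree (w, w₁) →
      a ∈ T.halfTree (g • (w, w₁)) → b ∈ T.halfTree (g • (w, w₁)) := by
    intro a b r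
    induction r with
    | nil => exact fun _ => id
    | @cons a b c hab _ ih =>
      intro ha ha'
      have hb : b ∉ T.halfTree (w, w₁) := fun hb => ha (hab.reachable.trans hb)
      refine ih hb ?_
      by_contra hb'
      have := hT.eq_of_crosses_halfTree hge ((deleteEdges_le _) hab) ha' hb'
      simp only [Prod.smul_mk, Prod.mk.injEq] at this
      exact hb (this.1 ▸ hgw)
  refine hw (key (r.mapLe ?_) hz' hz)
  rw [Sym2.eq_swap]
  rfl

lemma IsTree.pow_smul_ne_of_mem_axisEdges (hT : T.IsTree)
    (hadj : ∀ (g : G) (u v : W), T.Adj u v → T.Adj (g • u) (g • v)) {g : G}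
    (hg : ∀ w : W, g • w ≠ w) {e : W × W} (he : e ∈ T.axisEdges g) {n : ℕ} (hn : 0 < n) :
    g ^ n • e ≠ e := by
  intro hfix
  have hsub : ∀ k : ℕ, T.halfTree (g ^ (k + 1) • e) ⊆ T.halfTree (g • e) := by
    intro k
    induction k with
    | zero => simp
    | succ k ih =>
      refine Set.Subset.trans ?_ ih
      exact (smul_mem_axisEdges hadj (Commute.pow_left rfl (k + 1)) he).2.trans' (by
        rw [smul_smul, ← pow_succ'])
  have heq : T.halfTree (g • e) = T.halfTree e := by
    refine he.2.antisymm ?_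
    have := hsub (n - 1)
    rwa [Nat.sub_add_cancel hn, hfix] at this
  have h1 : g • e.1 ∉ T.halfTree e := by
    rw [← heq, smul_mem_halfTree_iff hadj]
    exact hT.fst_notMem_halfTree he.1
  have h2 : g • e.2 ∈ T.halfTree e := heq ▸ snd_mem_halfTree (g • e)
  have := hT.eq_of_crosses_halfTree he.1 (hadj g _ _ he.1).symm h2 h1
  exact hg e.1 (congrArg Prod.fst this).symm

lemma IsTree.zpow_smul_injective_of_mem_axisEdges (hT : T.IsTree)
    (hadj : ∀ (g : G) (u v : W), T.Adj u v → T.Adj (g • u) (g • v)) {g : G}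
    (hg : ∀ w : W, g • w ≠ w) {e : W × W} (he : e ∈ T.axisEdges g) :
    Function.Injective fun k : ℤ => g ^ k • e := by
  have hlt : ∀ i j : ℤ, i < j → g ^ i • e ≠ g ^ j • e := by
    intro i j hij h
    obtain ⟨n, hn⟩ := Int.eq_ofNat_of_zero_le (sub_pos.2 hij).le
    refine hT.pow_smul_ne_of_mem_axisEdges hadj hg he (n := n) (by omega) ?_
    rw [← zpow_natCast, ← hn, sub_eq_neg_add, zpow_add, mul_smul, ← h, smul_smul]
    simp
  intro i j h
  by_contra hij
  rcases lt_or_gt_of_ne hij with hij | hij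
  · exact hlt i j hij h
  · exact hlt j i hij h.symm

lemma pow_smul_mem_halfTree (hadj : ∀ (g : G) (u v : W), T.Adj u v → T.Adj (g • u) (g • v))
    {g : G} {e : W × W} (he : e ∈ T.axisEdges g) {w : W} (hw : w ∈ T.halfTree e) (n : ℕ) :
    g ^ n • w ∈ T.halfTree e := by
  induction n with
  | zero => simpa
  | succ n ih =>
    rw [pow_succ', mul_smul]
    exact he.2 (smul_mem_halfTree hadj g ih)

lemma mem_halfTree_zpow_smul_iff
    (hadj : ∀ (g : G) (u v : W), T.Adj u v → T.Adj (g • u) (g • v))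
    (g : G) (k : ℤ) (e : W × W) (w : W) :
    w ∈ T.halfTree (g ^ k • e) ↔ g ^ (-k) • w ∈ T.halfTree e := by
  rw [← smul_mem_halfTree_iff hadj (g ^ k) (w := g ^ (-k) • w), zpow_neg, smul_inv_smul]

lemma IsTree.exists_zpow_smul_mem_separating (hT : T.IsTree)
    (hadj : ∀ (g : G) (u v : W), T.Adj u v → T.Adj (g • u) (g • v)) {g : G}
    (hg : ∀ w : W, g • w ≠ w) {e : W × W} (he : e ∈ T.axisEdges g) (w : W) :
    ∃ k : ℤ, w ∉ T.halfTree (g ^ k • e) ∧ g • w ∈ T.halfTree (g ^ k • e) := by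
  have hinj := hT.zpow_smul_injective_of_mem_axisEdges hadj hg he
  have hadj' : ∀ k : ℤ, T.Adj (g ^ k • e).1 (g ^ k • e).2 := fun k => hadj _ _ _ he.1
  have hpos : ∃ n : ℕ, g ^ (n : ℤ) • w ∈ T.halfTree e := by
    by_contra! h
    refine Set.infinite_of_injective_forall_mem (f := fun n : ℕ => g ^ (-n : ℤ) • e)
      (fun a b hab => by simpa using hinj hab) (fun n => ?_) (hT.finite_separating w e.2)
    refine ⟨hadj' _, ?_, ?_⟩
    · rw [mem_halfTree_zpow_smul_iff hadj, neg_neg]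
      exact h n
    · rw [mem_halfTree_zpow_smul_iff hadj, neg_neg, zpow_natCast]
      exact pow_smul_mem_halfTree hadj he (snd_mem_halfTree e) n
  have hneg : ∃ n : ℕ, g ^ (-n : ℤ) • w ∉ T.halfTree e := by
    by_contra! h
    refine Set.infinite_of_injective_forall_mem (f := fun n : ℕ => g ^ (n : ℤ) • e)
      (fun a b hab => by simpa using hinj hab) (fun n => ?_) (hT.finite_separating e.1 w)
    refine ⟨hadj' _, ?_, ?_⟩
    · rw [mem_halfTree_zpow_smul_iff hadj]
      intro hmem
      have := pow_smul_mem_halfTree hadj he hmem n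
      rw [← zpow_natCast, smul_smul, ← zpow_add, add_neg_cancel, zpow_zero, one_smul] at this
      exact hT.fst_notMem_halfTree he.1 this
    · rw [mem_halfTree_zpow_smul_iff hadj]
      exact h n
  obtain ⟨m, hm⟩ := hpos
  obtain ⟨n, hn⟩ := hneg
  by_contra! hstep
  have hall : ∀ k : ℤ, (-n : ℤ) ≤ k → g ^ k • w ∉ T.halfTree e := by
    intro k hk
    induction k, hk using Int.leInduction with
    | base => exact hn
    | succ k _ ih =>
      have := hstep (-k)
      rw [mem_halfTree_zpow_smul_iff hadj, mem_halfTree_zpow_smul_iff hadj, neg_neg, smul_smul,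
        ← zpow_add_one] at this
      exact this ih
  exact hall m (by omega) hm

/-- A power of an element commuting with a hyperbolic `g` agrees on an axis edge of `g` with
a power of `g`. -/
lemma IsTree.exists_zpow_mul_pow_smul_eq (hT : T.IsTree)
    (hadj : ∀ (g : G) (u v : W), T.Adj u v → T.Adj (g • u) (g • v)) {g : G}
    (hg : ∀ w : W, g • w ≠ w) {e : W × W} (he : e ∈ T.axisEdges g) {u : G} (hu : Commute u g) :
    ∃ (n : ℕ) (k : ℤ), 0 < n ∧ (g ^ k * u ^ n) • e = e := by
  have hmem : ∀ i : ℕ, u ^ i • e ∈ T.axisEdges g :=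
    fun i => smul_mem_axisEdges hadj (hu.pow_left i) he
  choose k hk using fun i => hT.exists_zpow_smul_mem_separating hadj hg (hmem i) e.1
  have hmaps : Set.MapsTo (fun i => g ^ k i • u ^ i • e) Set.univ
      {e' | T.Adj e'.1 e'.2 ∧ e.1 ∉ T.halfTree e' ∧ g • e.1 ∈ T.halfTree e'} :=
    fun i _ => ⟨hadj _ _ _ (hmem i).1, hk i⟩
  obtain ⟨i, -, j, -, hij, hfg⟩ := Set.infinite_univ.exists_lt_map_eq_of_mapsTo hmaps
    (hT.finite_separating e.1 (g • e.1))
  refine ⟨j - i, k j - k i, Nat.sub_pos_of_lt hij, ?_⟩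
  have hcomm : Commute (u ^ i) (g ^ (k j - k i)) := (hu.pow_left i).zpow_right _
  have hmul : g ^ k j * u ^ j = g ^ k i * u ^ i * (g ^ (k j - k i) * u ^ (j - i)) := by
    rw [mul_assoc, ← mul_assoc (u ^ i), hcomm.eq, mul_assoc, ← pow_add, ← mul_assoc, ← zpow_add,
      Nat.add_sub_cancel' hij.le, add_sub_cancel]
  simp only [smul_smul] at hfg
  rw [hmul, mul_smul (g ^ k i * u ^ i), smul_left_cancel_iff] at hfg
  exact hfg.symm

/-- If edge stabilizers are abelian, then any two elements of the centralizer of a hyperbolic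
element have commuting powers. -/
lemma IsTree.exists_commute_pow (hT : T.IsTree)
    (hadj : ∀ (g : G) (u v : W), T.Adj u v → T.Adj (g • u) (g • v)) {g : G}
    (hinv : ∀ u v : W, T.Adj u v → ¬ (g • u = v ∧ g • v = u)) (hg : ∀ w : W, g • w ≠ w)
    (hab : ∀ u v : W, T.Adj u v → ∀ a b : G, a • u = u → a • v = v → b • u = u → b • v = v →
      a * b = b * a)
    {a b : G} (ha : Commute a g) (hb : Commute b g) :
    ∃ m n : ℕ, 0 < m ∧ 0 < n ∧ Commute (a ^ m) (b ^ n) := by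
  obtain ⟨e, he⟩ := hT.axisEdges_nonempty hadj hinv hg
  obtain ⟨m, k, hm, hmk⟩ := hT.exists_zpow_mul_pow_smul_eq hadj hg he ha
  obtain ⟨n, l, hn, hnl⟩ := hT.exists_zpow_mul_pow_smul_eq hadj hg he hb
  refine ⟨m, n, hm, hn, ?_⟩
  have h : Commute (g ^ k * a ^ m) (g ^ l * b ^ n) :=
    hab _ _ he.1 _ _ (congrArg Prod.fst hmk) (congrArg Prod.snd hmk) (congrArg Prod.fst hnl)
      (congrArg Prod.snd hnl)
  have hga (r : ℤ) : Commute (g ^ r) (a ^ m) := ((ha.pow_left m).zpow_right r).symm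
  have hgb (r : ℤ) : Commute (g ^ r) (b ^ n) := ((hb.pow_left n).zpow_right r).symm
  have hgg (r s : ℤ) : Commute (g ^ r) (g ^ s) := Commute.zpow_zpow_self g r s
  have h1 : Commute (g ^ (-k)) (g ^ l * b ^ n) := (hgg _ _).mul_right (hgb _)
  have h2 : Commute (a ^ m) (g ^ l * b ^ n) := by simpa [zpow_neg] using h1.mul_left h
  have h3 : Commute (a ^ m) (g ^ (-l)) := (hga _).symm
  simpa [zpow_neg] using h3.mul_right h2

end Action

end SimpleGraph

namespace RAAG

variable {V : Type} {Γ : SimpleGraph V} {H : Type*} [Group H]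

/-- The homomorphism out of `RAAG Γ` determined by a map on vertices sending adjacent vertices
to commuting elements. -/
def lift (f : V → H) (hf : ∀ u w, Γ.Adj u w → Commute (f u) (f w)) : RAAG Γ →* H :=
  PresentedGroup.toGroup (rels := raagRels Γ) (f := f) (by
    rintro _ ⟨u, w, huw, rfl⟩
    simp [(hf u w huw).eq])

@[simp]
lemma lift_gen (f : V → H) (hf : ∀ u w, Γ.Adj u w → Commute (f u) (f w)) (u : V) :
    lift f hf (gen Γ u) = f u :=
  PresentedGroup.toGroup.of _

lemma commute_gen {u w : V} (h : Γ.Adj u w) : Commute (gen Γ u) (gen Γ w) := by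
  have : PresentedGroup.mk (raagRels Γ) _ = 1 :=
    PresentedGroup.one_of_mem (rels := raagRels Γ) ⟨u, w, h, rfl⟩
  rw [← commutatorElement_eq_one_iff_commute]
  simpa only [map_mul, map_inv, commutatorElement_def] using! this

open Matrix.SpecialLinearGroup ModularGroup in
lemma eq_or_adj_of_commute_pow {u w : V} {m n : ℕ} (hm : 0 < m) (hn : 0 < n)
    (h : Commute (gen Γ u ^ m) (gen Γ w ^ n)) : u = w ∨ Γ.Adj u w := by
  classical
  by_contra! hne
  obtain ⟨hne, hadj⟩ := hne
  let f : V → Matrix.SpecialLinearGroup (Fin 2) ℤ :=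
    fun x => if x = u then T else if x = w then S * T * S⁻¹ else 1
  have hf : ∀ a b, Γ.Adj a b → Commute (f a) (f b) := by
    intro a b hab
    simp only [f]
    split_ifs <;> subst_vars <;>
      first
      | exact Commute.refl _
      | exact Commute.one_left _
      | exact Commute.one_right _
      | exact absurd hab hadj
      | exact absurd hab.symm hadj
  have h' := h.map (lift f hf)
  simp only [map_pow, lift_gen, f, if_true, if_neg hne.symm, conj_pow] at h'
  have h00 := congrArg (fun A : Matrix.SpecialLinearGroup (Fin 2) ℤ => A.1 0 0) h'.eq
  have hT (k : ℕ) : (T ^ k).1 = !![1, (k : ℤ); 0, 1] := by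
    simpa using coe_T_zpow k
  simp only [Matrix.SpecialLinearGroup.coe_mul, hT, Matrix.SpecialLinearGroup.coe_inv, coe_S,
    Matrix.adjugate_fin_two] at h00
  simp [Matrix.mul_apply, Fin.sum_univ_two] at h00
  omega

/-- The subgroup of `RAAG Γ` generated by the vertices of a clique is free abelian. -/
lemma nonempty_closure_mulEquiv_of_isClique {s : Set V} (hs : Γ.IsClique s) :
    Nonempty (↥(Subgroup.closure (gen Γ '' s)) ≃* Multiplicative (FreeAbelianGroup ↥s)) := by
  classical
  let K := Subgroup.closure (gen Γ '' s)
  have hcomm : ∀ x ∈ gen Γ '' s, ∀ y ∈ gen Γ '' s, x * y = y * x := by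
    rintro _ ⟨a, ha, rfl⟩ _ ⟨b, hb, rfl⟩
    rcases eq_or_ne a b with rfl | hab
    · rfl
    · exact commute_gen (hs ha hb hab)
  let : CommGroup K :=
    { (inferInstance : Group K) with
      mul_comm := (Subgroup.isMulCommutative_closure hcomm).is_comm.comm }
  let fwd : RAAG Γ →* Multiplicative (FreeAbelianGroup ↥s) :=
    lift (fun x => if hx : x ∈ s then Multiplicative.ofAdd (FreeAbelianGroup.of ⟨x, hx⟩) else 1)
      fun _ _ _ => Commute.all _ _
  let vertex : s → Additive K := fun x =>
    Additive.ofMul ⟨gen Γ x, Subgroup.subset_closure ⟨x, x.2, rfl⟩⟩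
  let bwd : Multiplicative (FreeAbelianGroup ↥s) →* K :=
    AddMonoidHom.toMultiplicativeLeft (FreeAbelianGroup.lift vertex)
  have hbwd : ∀ (x : V) (hx : x ∈ s), bwd (Multiplicative.ofAdd (FreeAbelianGroup.of ⟨x, hx⟩)) =
      ⟨gen Γ x, Subgroup.subset_closure ⟨x, hx, rfl⟩⟩ := fun x hx =>
    FreeAbelianGroup.lift_apply_of vertex ⟨x, hx⟩
  have hfwd : ∀ (x : V) (hx : x ∈ s), fwd (gen Γ x) =
      Multiplicative.ofAdd (FreeAbelianGroup.of ⟨x, hx⟩) := fun x hx => by simp [fwd, hx]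
  refine ⟨MonoidHom.toMulEquiv (fwd.comp K.subtype) bwd ?_ ?_⟩
  · refine MonoidHom.eq_of_eqOn_dense Subgroup.closure_closure_coe_preimage ?_
    rintro ⟨_, _⟩ ⟨a, ha, rfl⟩
    simp [hfwd a ha, hbwd a ha]
  · apply MonoidHom.toAdditiveRight.injective
    refine FreeAbelianGroup.lift_ext _ _ fun x => ?_
    change fwd (bwd (Multiplicative.ofAdd (FreeAbelianGroup.of x)) : K) = _
    rw [hbwd x x.2, hfwd x x.2]
    rfl

lemma gen_mem_closure {s : Set V} {x : V} (hx : x ∈ s) :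
    gen Γ x ∈ Subgroup.closure (gen Γ '' s) :=
  Subgroup.subset_closure ⟨x, hx, rfl⟩

/-- If a graph is covered by two induced subgraphs, then homomorphisms out of the corresponding
subgroups of the right-angled Artin group that agree on common vertices can be glued. -/
lemma exists_hom_extending {s t : Set V} (hcover : ∀ x, x ∈ s ∨ x ∈ t)
    (hedge : ∀ x y, Γ.Adj x y → (x ∈ s ∧ y ∈ s) ∨ (x ∈ t ∧ y ∈ t))
    (f₀ : ↥(Subgroup.closure (gen Γ '' s)) →* H) (f₁ : ↥(Subgroup.closure (gen Γ '' t)) →* H)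
    (hagree : ∀ x (hs : x ∈ s) (ht : x ∈ t),
      f₀ ⟨gen Γ x, gen_mem_closure hs⟩ = f₁ ⟨gen Γ x, gen_mem_closure ht⟩) :
    ∃ F : RAAG Γ →* H, (∀ x : ↥(Subgroup.closure (gen Γ '' s)), F x = f₀ x) ∧
      ∀ x : ↥(Subgroup.closure (gen Γ '' t)), F x = f₁ x := by
  classical
  let f : V → H := fun x => if hx : x ∈ s then f₀ ⟨gen Γ x, gen_mem_closure hx⟩ else
    f₁ ⟨gen Γ x, gen_mem_closure ((hcover x).resolve_left hx)⟩
  have hf₀ {x : V} (hx : x ∈ s) : f x = f₀ ⟨gen Γ x, gen_mem_closure hx⟩ := dif_pos hx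
  have hf₁ {x : V} (hx : x ∈ t) : f x = f₁ ⟨gen Γ x, gen_mem_closure hx⟩ := by
    by_cases hxs : x ∈ s
    · rw [hf₀ hxs, hagree x hxs hx]
    · exact dif_neg hxs
  have hf : ∀ x y, Γ.Adj x y → Commute (f x) (f y) := by
    intro x y hxy
    rcases hedge x y hxy with ⟨hx, hy⟩ | ⟨hx, hy⟩
    · rw [hf₀ hx, hf₀ hy]
      exact Commute.map (Subtype.ext (commute_gen hxy).eq) f₀
    · rw [hf₁ hx, hf₁ hy]
      exact Commute.map (Subtype.ext (commute_gen hxy).eq) f₁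
  refine ⟨lift f hf, DFunLike.congr_fun (f := (lift f hf).comp (Subgroup.subtype _)) (g := f₀)
    (MonoidHom.eq_of_eqOn_dense Subgroup.closure_closure_coe_preimage ?_),
    DFunLike.congr_fun (f := (lift f hf).comp (Subgroup.subtype _)) (g := f₁)
    (MonoidHom.eq_of_eqOn_dense Subgroup.closure_closure_coe_preimage ?_)⟩
  · rintro ⟨_, _⟩ ⟨a, ha, rfl⟩
    simp [hf₀ ha]
  · rintro ⟨_, _⟩ ⟨a, ha, rfl⟩
    simp [hf₁ ha]

/-- If a graph is covered by two induced subgraphs, then its right-angled Artin group is the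
amalgamated product of the corresponding subgroups. -/
lemma nonempty_mulEquiv_pushoutI {s t : Set V} (hcover : ∀ x, x ∈ s ∨ x ∈ t)
    (hedge : ∀ x y, Γ.Adj x y → (x ∈ s ∧ y ∈ s) ∨ (x ∈ t ∧ y ∈ t))
    {r : Set V} (hr : r = s ∩ t)
    (h0 : Subgroup.closure (gen Γ '' r) ≤ Subgroup.closure (gen Γ '' s))
    (h1 : Subgroup.closure (gen Γ '' r) ≤ Subgroup.closure (gen Γ '' t)) :
    Nonempty (RAAG Γ ≃* Monoid.PushoutI (amalgMaps h0 h1)) := by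
  let of₀ : ↥(Subgroup.closure (gen Γ '' s)) →* Monoid.PushoutI (amalgMaps h0 h1) :=
    Monoid.PushoutI.of (φ := amalgMaps h0 h1) false
  let of₁ : ↥(Subgroup.closure (gen Γ '' t)) →* Monoid.PushoutI (amalgMaps h0 h1) :=
    Monoid.PushoutI.of (φ := amalgMaps h0 h1) true
  obtain ⟨F, hF₀, hF₁⟩ := exists_hom_extending hcover hedge of₀ of₁ fun x hs ht =>
    have hx : gen Γ x ∈ Subgroup.closure (gen Γ '' r) := gen_mem_closure (hr ▸ ⟨hs, ht⟩)
    (Monoid.PushoutI.of_apply_eq_base (amalgMaps h0 h1) false ⟨_, hx⟩).trans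
      (Monoid.PushoutI.of_apply_eq_base (amalgMaps h0 h1) true ⟨_, hx⟩).symm
  let incl : (i : Bool) → ↥(cond i (Subgroup.closure (gen Γ '' t))
      (Subgroup.closure (gen Γ '' s))) →* RAAG Γ := fun i => Subgroup.subtype _
  have hincl : ∀ i, (incl i).comp (amalgMaps h0 h1 i) = Subgroup.subtype _ := by
    rintro (_ | _) <;> rfl
  let E : Monoid.PushoutI (amalgMaps h0 h1) →* RAAG Γ := Monoid.PushoutI.lift incl _ hincl
  have hE₀ (x) : E (of₀ x) = x :=
    Monoid.PushoutI.lift_of (φ := amalgMaps h0 h1) incl _ hincl (i := false) x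
  have hE₁ (x) : E (of₁ x) = x :=
    Monoid.PushoutI.lift_of (φ := amalgMaps h0 h1) incl _ hincl (i := true) x
  refine ⟨MonoidHom.toMulEquiv F E ?_ ?_⟩
  · refine PresentedGroup.ext fun x => ?_
    rcases hcover x with hx | hx
    · exact (congrArg E (hF₀ ⟨_, gen_mem_closure hx⟩)).trans (hE₀ _)
    · exact (congrArg E (hF₁ ⟨_, gen_mem_closure hx⟩)).trans (hE₁ _)
  · refine Monoid.PushoutI.hom_ext_nonempty ?_
    rintro (_ | _) <;> ext x
    · exact (congrArg F (hE₀ x)).trans (hF₀ x)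
    · exact (congrArg F (hE₁ x)).trans (hF₁ x)

/-- The star of a vertex acting hyperbolically with abelian edge stabilizers is a clique. -/
lemma isClique_star_of_not_elliptic {W : Type} {T : SimpleGraph W} (hT : T.IsTree)
    {φ : RAAG Γ →* Equiv.Perm W} (hadj : PreservesAdj T φ) (hni : NoInversions T φ)
    (hab : AbelianEdgeStabilizers T φ) {v : V} (hv : ¬ Elliptic φ (gen Γ v)) :
    Γ.IsClique (insert v (Γ.neighborSet v)) := by
  let : MulAction (RAAG Γ) W := MulAction.compHom W φ
  have hcomm : ∀ x ∈ insert v (Γ.neighborSet v), Commute (gen Γ x) (gen Γ v) := by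
    rintro x (rfl | hx)
    · exact Commute.refl _
    · exact (commute_gen hx).symm
  intro x hx y hy hxy
  obtain ⟨m, n, hm, hn, h⟩ := hT.exists_commute_pow hadj (hni (gen Γ v))
    (fun w hw => hv ⟨w, hw⟩) hab (hcomm x hx) (hcomm y hy)
  exact (eq_or_adj_of_commute_pow hm hn h).resolve_left hxy

end RAAG

/-- Suppose `A(Γ)` acts without inversions on a simplicial tree with abelian edge
stabilizers and `v ∈ V(Γ)` acts hyperbolically. Write
`star(v) = star_h(v) ⊔ star_e(v)` according to whether vertices act hyperbolically
or elliptically, and let `Γ′ = Γ ∖ star_h(v)`. Then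
`A(Γ) = A(Γ′) ∗_{A(star_e(v))} A(star(v))`, with `A(star(v))` free abelian. -/
theorem splitting_off_hyperbolic_star {V W : Type} [Finite V]
    (Γ : SimpleGraph V) (T : SimpleGraph W) (hT : T.IsTree)
    (φ : RAAG Γ →* Equiv.Perm W)
    (hadj : PreservesAdj T φ) (hni : NoInversions T φ)
    (hab : AbelianEdgeStabilizers T φ)
    (v : V) (hv : ¬ Elliptic φ (RAAG.gen Γ v))
    (starv starE Γ' : Set V)
    (hstarv : starv = insert v (Γ.neighborSet v))
    (hstarE : starE = {u ∈ starv | Elliptic φ (RAAG.gen Γ u)})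
    (hΓ' : Γ' = {u | u ∉ starv ∨ Elliptic φ (RAAG.gen Γ u)}) :
    ∃ (hle0 : Subgroup.closure (RAAG.gen Γ '' starE) ≤
        Subgroup.closure (RAAG.gen Γ '' Γ'))
      (hle1 : Subgroup.closure (RAAG.gen Γ '' starE) ≤
        Subgroup.closure (RAAG.gen Γ '' starv)),
      Nonempty (↥(Subgroup.closure (RAAG.gen Γ '' starv)) ≃*
        Multiplicative (FreeAbelianGroup ↥starv)) ∧
      Nonempty (RAAG Γ ≃* Monoid.PushoutI (amalgMaps hle0 hle1)) := by
  have hclique : ∀ u, ¬ Elliptic φ (RAAG.gen Γ u) → Γ.IsClique (insert u (Γ.neighborSet u)) :=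
    fun u hu => RAAG.isClique_star_of_not_elliptic hT hadj hni hab hu
  have hstar : ∀ x y, Γ.Adj x y → x ∈ starv → ¬ Elliptic φ (RAAG.gen Γ x) → y ∈ starv := by
    intro x y hxy hx hxh
    rw [hstarv] at hx ⊢
    by_cases hyv : y = v
    · exact Or.inl hyv
    rcases hx with rfl | hx
    · exact Or.inr hxy
    · exact Or.inr (hclique x hxh (Or.inr hx.symm) (Or.inr hxy) (Ne.symm hyv))
  have hinter : starE = Γ' ∩ starv := by
    subst hstarE hΓ'
    ext x
    simp only [Set.mem_ofPred_eq, Set.mem_inter_iff]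
    tauto
  have hle0 := Subgroup.closure_mono (Set.image_mono (f := RAAG.gen Γ)
    (hinter.subset.trans Set.inter_subset_left))
  have hle1 := Subgroup.closure_mono (Set.image_mono (f := RAAG.gen Γ)
    (hinter.subset.trans Set.inter_subset_right))
  refine ⟨hle0, hle1, RAAG.nonempty_closure_mulEquiv_of_isClique (hstarv ▸ hclique v hv),
    RAAG.nonempty_mulEquiv_pushoutI ?_ ?_ hinter hle0 hle1⟩
  · intro x
    rw [hΓ', Set.mem_ofPred_eq]
    tauto
  · intro x y hxy
    have hx := hstar x y hxy
    have hy := hstar y x hxy.symm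
    rw [hΓ', Set.mem_ofPred_eq, Set.mem_ofPred_eq]
    tauto
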